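/- Let p be a depth-zero pattern of the form r q r (beginning and ending with r) whose only bifix is the single letter r, and suppose p has dimensions (b+1)×d (so p has b+1 letters r and d letters u, with b ≥ 1). Then for all integers m ≥ n ≥ 1, in ℚ: s_p(n, m) = (m − n + 1) · Σ_{i ≥ 0, b·i ≤ n−1} (−1)^i · (1/(m − d·i + 1)) · C(n − (b−1)i − 1, i) · C(m + n − (d+b)i, n − b·i). -/

import Mathlib

/-- A step of a lattice path: `u` (up) or `r` (right). -/
inductive Step : Type
  | u : Step
  | r : Step
deriving DecidableEq

/-- A word over the alphabet `{u, r}`. -/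
abbrev Word := List Step

/-- The number of letters `r` in a word. -/
def countR (w : Word) : ℕ := w.count Step.r

/-- The number of letters `u` in a word. -/
def countU (w : Word) : ℕ := w.count Step.u

/-- `dval q` = (number of `r`'s in `q`) - (number of `u`'s in `q`). -/
def dval (w : Word) : ℤ := (countR w : ℤ) - (countU w : ℤ)

/-- A pattern is depth-zero if every suffix `q` of it satisfies `dval q ≥ 0`. -/
def DepthZero (p : Word) : Prop := ∀ q : Word, q <:+ p → 0 ≤ dval q

/-- `o` is a bifix of `p`: a nonempty proper prefix of `p` that is also a (proper) suffix. -/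
def IsBifix (o p : Word) : Prop := o ≠ [] ∧ o ≠ p ∧ o <+: p ∧ o <:+ p

/-- A pattern is bifix-free if it has no bifix. -/
def BifixFree (p : Word) : Prop := ∀ o : Word, ¬ IsBifix o p

/-- `w` is a ballot path to the lattice point `(n, m)`: it has exactly `n` letters `r`
and `m` letters `u`, and every prefix has at least as many `u`'s as `r`'s. -/
def IsBallot (w : Word) (n m : ℤ) : Prop :=
  (countR w : ℤ) = n ∧ (countU w : ℤ) = m ∧
    ∀ t : Word, t <+: w → countR t ≤ countU t

/-- `w` avoids the pattern `p`: `p` does not occur in `w` as a contiguous substring. -/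
def Avoids (p w : Word) : Prop := ¬ p <:+: w

/-- `s p n m` is the number of ballot paths to `(n, m)` avoiding `p`
(`0` if `n < 0`, `m < 0`, or `m < n`, since then no such path exists). -/
noncomputable def s (p : Word) (n m : ℤ) : ℕ :=
  Set.ncard {w : Word | IsBallot w n m ∧ Avoids p w}

namespace BallotAvoiding

instance : Finite Step :=
  Finite.of_surjective (fun x : Bool => if x then Step.u else Step.r)
    (fun y => by cases y <;> simp)

/-- Ballot paths to `(n, m)` that contain `p`, but only as a suffix. -/
def endingAt (p : Word) (n m : ℤ) : Set Word :=
  {w | IsBallot w n m ∧ p <:+ w ∧ Avoids p w.dropLast}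

/-- Ballot paths to `(n, m)` avoiding `p`. -/
def avoiding (p : Word) (n m : ℤ) : Set Word :=
  {w | IsBallot w n m ∧ Avoids p w}

lemma s_eq (p : Word) (n m : ℤ) : s p n m = (avoiding p n m).ncard := rfl

@[simp] lemma countR_append (v w : Word) : countR (v ++ w) = countR v + countR w := by
  simp [countR]

@[simp] lemma countU_append (v w : Word) : countU (v ++ w) = countU v + countU w := by
  simp [countU]

lemma length_eq_counts (w : Word) : w.length = countR w + countU w := by
  induction w with
  | nil => simp [countR, countU]
  | cons a w ih => cases a <;> simp_all [countR, countU] <;> omega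

lemma finite_isBallot (n m : ℤ) : {w : Word | IsBallot w n m}.Finite := by
  refine (List.finite_length_eq Step (n + m).toNat).subset ?_
  rintro w ⟨h1, h2, -⟩
  have := length_eq_counts w
  simp only [Set.mem_ofPred_eq]
  omega

lemma finite_avoiding (p : Word) (n m : ℤ) : (avoiding p n m).Finite :=
  (finite_isBallot n m).subset fun _ h => h.1

lemma finite_endingAt (p : Word) (n m : ℤ) : (endingAt p n m).Finite :=
  (finite_isBallot n m).subset fun _ h => h.1

lemma le_of_isBallot {w : Word} {n m : ℤ} (h : IsBallot w n m) : n ≤ m := by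
  have := h.2.2 w List.prefix_rfl
  have := h.1
  have := h.2.1
  omega

lemma s_eq_zero_of_lt {p : Word} {n m : ℤ} (h : m < n) : s p n m = 0 := by
  rw [s_eq, Set.ncard_eq_zero (finite_avoiding p n m), Set.eq_empty_iff_forall_notMem]
  rintro w ⟨hw, -⟩
  exact absurd (le_of_isBallot hw) (not_le.2 h)

lemma s_eq_zero_of_neg {p : Word} {n m : ℤ} (h : n < 0) : s p n m = 0 := by
  rw [s_eq, Set.ncard_eq_zero (finite_avoiding p n m), Set.eq_empty_iff_forall_notMem]
  rintro w ⟨⟨hw, -⟩, -⟩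
  omega

lemma s_zero_zero {p : Word} (hp : p ≠ []) : s p 0 0 = 1 := by
  rw [s_eq, Set.ncard_eq_one]
  refine ⟨[], Set.eq_singleton_iff_unique_mem.2 ⟨⟨⟨by simp [countR], by simp [countU], ?_⟩, ?_⟩, ?_⟩⟩
  · intro t ht
    simp [List.prefix_nil.1 ht, countR]
  · intro h
    exact hp (List.infix_nil.1 h)
  · rintro w ⟨⟨h1, h2, -⟩, -⟩
    have := length_eq_counts w
    exact List.length_eq_zero_iff.1 (by omega)

/-- A word ending in a word all of whose suffixes have nonnegative `dval` is ballot as soon as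
its prefix is ballot and its endpoint is weakly above the diagonal. -/
lemma isBallot_append {v p : Word} (hdz : DepthZero p) {n m : ℤ} (hnm : n ≤ m) :
    IsBallot (v ++ p) n m ↔ IsBallot v (n - countR p) (m - countU p) := by
  constructor
  · rintro ⟨h1, h2, h3⟩
    refine ⟨by simp at h1; omega, by simp at h2; omega, fun t ht => h3 t ?_⟩
    exact ht.trans (List.prefix_append _ _)
  · rintro ⟨h1, h2, h3⟩
    refine ⟨by simp; omega, by simp; omega, fun t ht => ?_⟩
    obtain ⟨x, hx⟩ := ht
    rcases List.append_eq_append_iff.1 hx with ⟨o, rfl, -⟩ | ⟨o, rfl, rfl⟩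
    · exact h3 t (List.prefix_append _ _)
    · have := h3 v List.prefix_rfl
      have := hdz x (List.suffix_append _ _)
      simp [dval] at *
      omega

lemma isBallot_append_r {v : Word} {n m : ℤ} (hnm : n ≤ m) :
    IsBallot (v ++ [Step.r]) n m ↔ IsBallot v (n - 1) m := by
  rw [isBallot_append _ hnm]
  · simp [countR, countU]
  · intro t ht
    rcases List.suffix_cons_iff.1 ht with rfl | h
    · simp [dval, countR, countU]
    · simp [List.suffix_nil.1 h, dval, countR, countU]

lemma isBallot_append_u {v : Word} {n m : ℤ} :
    IsBallot (v ++ [Step.u]) n m ↔ IsBallot v n (m - 1) := by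
  constructor
  · rintro ⟨h1, h2, h3⟩
    refine ⟨by simpa [countR] using h1, by simp [countU] at h2 ⊢; omega, fun t ht => h3 t ?_⟩
    exact ht.trans (List.prefix_append _ _)
  · rintro ⟨h1, h2, h3⟩
    refine ⟨by simpa [countR] using h1, by simp [countU] at h2 ⊢; omega, fun t ht => ?_⟩
    rcases List.prefix_concat_iff.1 ht with rfl | h
    · have := h3 v List.prefix_rfl
      simp [countR, countU] at *
      omega
    · exact h3 t h

lemma infix_concat {α : Type*} {p v : List α} {x : α} :
    p <:+: v ++ [x] ↔ p <:+ v ++ [x] ∨ p <:+: v := by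
  constructor
  · rintro ⟨a, c, h⟩
    rcases List.eq_nil_or_concat c with rfl | ⟨c, y, rfl⟩
    · exact Or.inl ⟨a, by simpa using h⟩
    · right
      rw [List.concat_eq_append, ← List.append_assoc] at h
      exact ⟨a, c, (List.append_inj' h rfl).1⟩
  · rintro (h | h)
    · exact h.isInfix
    · exact h.trans (List.prefix_append _ _).isInfix

lemma s_add_endingAt {p : Word} (hp : p ≠ []) {n m : ℤ} (hnm : n ≤ m)
    (h0 : ¬ (n = 0 ∧ m = 0)) :
    s p n m + (endingAt p n m).ncard = s p n (m - 1) + s p (n - 1) m := by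
  have hinj : ∀ x : Step, Function.Injective (fun w : Word => w ++ [x]) :=
    fun x => List.append_left_injective [x]
  simp only [s_eq]
  rw [← Set.ncard_image_of_injective (avoiding p n (m - 1)) (hinj Step.u),
    ← Set.ncard_image_of_injective (avoiding p (n - 1) m) (hinj Step.r),
    ← Set.ncard_union_eq ?_ (finite_avoiding p n m) (finite_endingAt p n m),
    ← Set.ncard_union_eq ?_ ((finite_avoiding p _ _).image _) ((finite_avoiding p _ _).image _)]
  · congr 1
    ext w
    rcases List.eq_nil_or_concat w with rfl | ⟨v, x, rfl⟩
    · simp only [avoiding, endingAt, Set.mem_union, Set.mem_ofPred_eq, Set.mem_image]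
      constructor
      · rintro (⟨⟨h1, h2, -⟩, -⟩ | ⟨-, h, -⟩)
        · simp [countR, countU] at h1 h2
          omega
        · exact absurd (List.suffix_nil.1 h) hp
      · simp
    · have hsub : Avoids p (v ++ [x]) → Avoids p v := fun h h' =>
        h (infix_concat.2 (Or.inr h'))
      have hdich : (Avoids p (v ++ [x]) ∨ p <:+ (v ++ [x]) ∧ Avoids p v) ↔ Avoids p v := by
        simp only [Avoids, infix_concat]
        tauto
      simp only [avoiding, endingAt, Set.mem_union, Set.mem_ofPred_eq, Set.mem_image,
        List.concat_eq_append, List.dropLast_concat]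
      rw [← and_or_left, hdich]
      cases x
      · rw [isBallot_append_u]
        constructor
        · exact fun h => Or.inl ⟨v, h, rfl⟩
        · rintro (⟨v', h, he⟩ | ⟨v', h, he⟩)
          · rwa [← hinj _ he]
          · simp at he
      · rw [isBallot_append_r hnm]
        constructor
        · exact fun h => Or.inr ⟨v, h, rfl⟩
        · rintro (⟨v', h, he⟩ | ⟨v', h, he⟩)
          · simp at he
          · rwa [← hinj _ he]
  · rw [Set.disjoint_left]
    rintro _ ⟨v, -, rfl⟩ ⟨v', -, he⟩
    simp at he
  · rw [Set.disjoint_left]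
    rintro w ⟨-, h⟩ ⟨-, hs, -⟩
    exact h hs.isInfix

/-- If the only bifix of `p` is `[r]` and `v` avoids `p`, then the only way for `p` to occur
early in `v ++ p` is by an overlap in the letter `r`. -/
lemma infix_dropLast_iff {p q v : Word} (hform : p = Step.r :: (q ++ [Step.r]))
    (huniq : ∀ o : Word, IsBifix o p → o = [Step.r]) (hv : Avoids p v) :
    p <:+: (v ++ p).dropLast ↔ p <:+ v ++ [Step.r] := by
  have hdl : (v ++ p).dropLast = v ++ [Step.r] ++ q := by
    rw [hform, show v ++ Step.r :: (q ++ [Step.r]) = (v ++ [Step.r] ++ q) ++ [Step.r] by simp,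
      List.dropLast_concat]
  rw [hdl]
  constructor
  · rintro ⟨x, y, h⟩
    have h2 : (x ++ p) ++ (y ++ [Step.r]) = v ++ p := by
      rw [← List.append_assoc, h, hform]
      simp
    rcases List.append_eq_append_iff.1 h2 with ⟨o, hv', -⟩ | ⟨o, hxp, hp⟩
    · exact absurd ⟨x, o, hv'.symm⟩ hv
    · have hlen : o.length < p.length := by
        rw [hp]
        simp
      have hsuf : o <:+ p := List.suffix_of_suffix_length_le ⟨v, hxp.symm⟩ ⟨x, rfl⟩ hlen.le
      by_cases ho : o = []
      · subst ho
        exact absurd ⟨x, [], by simpa using hxp⟩ hv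
      · have := huniq o ⟨ho, fun h => by simp [h] at hlen, ⟨_, hp.symm⟩, hsuf⟩
        subst this
        exact ⟨x, hxp⟩
  · intro h
    exact h.isInfix.trans (List.prefix_append _ _).isInfix

lemma s_eq_endingAt_add {p q : Word} {b d : ℕ} (hform : p = Step.r :: (q ++ [Step.r]))
    (hdz : DepthZero p) (huniq : ∀ o : Word, IsBifix o p → o = [Step.r])
    (hdimR : countR p = b + 1) (hdimU : countU p = d) (hdb : d ≤ b)
    {n m : ℤ} (hnm : n ≤ m) :
    s p (n - b - 1) (m - d) = (endingAt p n m).ncard + (endingAt p (n - b) (m - d)).ncard := by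
  have hlast : ∀ w : Word, p <:+ w → ∃ v, w = v ++ [Step.r] := by
    rintro w ⟨x, rfl⟩
    exact ⟨x ++ Step.r :: q, by simp [hform]⟩
  have hA : endingAt p n m = (fun v => v ++ p) ''
      {v | v ∈ avoiding p (n - b - 1) (m - d) ∧ ¬ p <:+ v ++ [Step.r]} := by
    ext w
    simp only [endingAt, avoiding, Set.mem_image, Set.mem_ofPred_eq]
    have hb : ∀ v, IsBallot (v ++ p) n m ↔ IsBallot v (n - b - 1) (m - d) := by
      intro v
      rw [isBallot_append hdz hnm, hdimR, hdimU]
      push_cast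
      rw [sub_sub]
    constructor
    · rintro ⟨h1, ⟨v, rfl⟩, h3⟩
      have hv : Avoids p v := by
        intro h
        apply h3
        rw [List.dropLast_append_of_ne_nil (by simp [hform])]
        exact h.trans (List.prefix_append _ _).isInfix
      refine ⟨v, ⟨⟨(hb v).1 h1, hv⟩, ?_⟩, rfl⟩
      rwa [← infix_dropLast_iff hform huniq hv]
    · rintro ⟨v, ⟨⟨h1, h2⟩, h3⟩, rfl⟩
      refine ⟨(hb v).2 h1, List.suffix_append _ _, ?_⟩
      rwa [Avoids, infix_dropLast_iff hform huniq h2]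
  have hB : endingAt p (n - b) (m - d) = (fun v => v ++ [Step.r]) ''
      {v | v ∈ avoiding p (n - b - 1) (m - d) ∧ p <:+ v ++ [Step.r]} := by
    have hle : n - b ≤ m - d := by omega
    ext w
    simp only [endingAt, avoiding, Set.mem_image, Set.mem_ofPred_eq]
    constructor
    · rintro ⟨h1, h2, h3⟩
      obtain ⟨v, rfl⟩ := hlast w h2
      exact ⟨v, ⟨⟨(isBallot_append_r hle).1 h1, by simpa using h3⟩, h2⟩, rfl⟩
    · rintro ⟨v, ⟨⟨h1, h2⟩, h3⟩, rfl⟩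
      exact ⟨(isBallot_append_r hle).2 h1, h3, by simpa using h2⟩
  rw [hA, hB, Set.ncard_image_of_injective _ (List.append_left_injective p),
    Set.ncard_image_of_injective _ (List.append_left_injective [Step.r]), ← Set.ncard_union_eq ?_
      ((finite_avoiding p _ _).subset fun _ h => h.1)
      ((finite_avoiding p _ _).subset fun _ h => h.1), s_eq]
  · congr 1
    ext v
    simp only [Set.mem_union, Set.mem_ofPred_eq]
    tauto
  · rw [Set.disjoint_left]
    rintro v ⟨-, h⟩ ⟨-, h'⟩
    exact h h'

lemma le_of_depthZero {p q : Word} {b d : ℕ} (hform : p = Step.r :: (q ++ [Step.r]))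
    (hdz : DepthZero p) (hdimR : countR p = b + 1) (hdimU : countU p = d) : d ≤ b := by
  have := hdz (q ++ [Step.r]) ⟨[Step.r], by simp [hform]⟩
  subst hform
  simp [dval, countR, countU] at *
  omega

/-- The summand of the explicit formula, with `n - b * i = k + 1` and `m - d * i = M`,
expressed through binomial coefficients only. -/
def summand (b d k i M : ℕ) : ℚ :=
  (k + i).choose k * ((M + k + 1).choose (k + 1) - (M + k + 1).choose k) +
    ((d : ℚ) - b) * (k + i).choose (k + 1) * (M + k + 1).choose k

lemma summand_eq (b d k i M : ℕ) :
    summand b d k i M = ((M : ℚ) - k + (d - b) * i) * (1 / (M + 1)) * (k + i).choose i *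
      (M + k + 1).choose (k + 1) := by
  have h1 : ((M + k + 1).choose (k + 1) : ℚ) * (k + 1) = (M + k + 1).choose k * (M + 1) := by
    have := Nat.choose_succ_right_eq (M + k + 1) k
    rw [show M + k + 1 - k = M + 1 by omega] at this
    exact_mod_cast this
  have h2 : ((k + i).choose (k + 1) : ℚ) * (k + 1) = (k + i).choose k * i := by
    have := Nat.choose_succ_right_eq (k + i) k
    rw [show k + i - k = i by omega] at this
    exact_mod_cast this
  have h3 : (k + i).choose i = (k + i).choose k := by
    rw [Nat.choose_symm_add]
  have hM : (M : ℚ) + 1 ≠ 0 := by positivity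
  have hk : (k : ℚ) + 1 ≠ 0 := by positivity
  have h1' : ((M + k + 1).choose k : ℚ) = (M + k + 1).choose (k + 1) * (k + 1) / (M + 1) := by
    field_simp
    linarith
  have h2' : ((k + i).choose (k + 1) : ℚ) = (k + i).choose k * i / (k + 1) := by
    field_simp
    linarith
  rw [summand, h1', h2', h3]
  field_simp
  ring

lemma summand_succ_zero (b d k M : ℕ) :
    summand b d (k + 1) 0 (M + 1) - summand b d (k + 1) 0 M = summand b d k 0 (M + 1) := by
  have e : M + 1 + (k + 1) + 1 = (M + k + 2) + 1 := by ring
  have e1 : M + (k + 1) + 1 = M + k + 2 := by ring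
  have e2 : M + 1 + k + 1 = M + k + 2 := by ring
  simp only [summand, e, e1, e2, Nat.choose_succ_succ (M + k + 2)]
  simp
  ring

lemma summand_succ_succ (b d k i M : ℕ) :
    (summand b d (k + 1) (i + 1) (M + 1) - summand b d (k + 1) (i + 1) M) -
      (summand b d (k + 1) i (M + 1) - summand b d (k + 1) i M) =
        summand b d k (i + 1) (M + 1) := by
  have e : M + 1 + (k + 1) + 1 = (M + k + 2) + 1 := by ring
  have e1 : M + (k + 1) + 1 = M + k + 2 := by ring
  have e2 : M + 1 + k + 1 = M + k + 2 := by ring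
  have e3 : k + 1 + (i + 1) = (k + i + 1) + 1 := by ring
  have e4 : k + 1 + i = k + i + 1 := by ring
  have e5 : k + (i + 1) = k + i + 1 := by ring
  simp only [summand, e, e1, e2, e3, e4, e5, Nat.choose_succ_succ (M + k + 2),
    Nat.choose_succ_succ (k + i + 1)]
  push_cast
  ring

lemma summand_zero (b d i M : ℕ) : summand b d 0 i M = M + ((d : ℚ) - b) * i := by
  simp [summand]

/-- The signed summand at `(n, m)`, extended by zero to the indices with `n ≤ b * i`. -/
def term (b d n m i : ℕ) : ℚ :=
  if b * i < n then (-1) ^ i * summand b d (n - b * i - 1) i (m - d * i) else 0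

/-- The value of the explicit formula at `(n, m)`. -/
def total (b d n m : ℕ) : ℚ := ∑ i ∈ Finset.range n, term b d n m i

lemma total_eq_sum {b : ℕ} (hb : 1 ≤ b) (d : ℕ) {n K : ℕ} (m : ℕ) (hK : n ≤ K) :
    total b d n m = ∑ i ∈ Finset.range K, term b d n m i := by
  refine Finset.sum_subset (Finset.range_mono hK) fun i _ hi => ?_
  rw [Finset.mem_range, not_lt] at hi
  rw [term, if_neg]
  nlinarith

lemma total_eq {b d : ℕ} (hb : 1 ≤ b) (hdb : d ≤ b) {n m : ℕ} (hn : 1 ≤ n) (hnm : n ≤ m + 1) :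
    total b d n m = ((m : ℚ) - n + 1) *
      ∑ i ∈ Finset.filter (fun i => b * i ≤ n - 1) (Finset.range n),
        (-1 : ℚ) ^ i * (1 / ((m : ℚ) - d * i + 1)) *
          (Nat.choose (n - (b - 1) * i - 1) i : ℚ) *
          (Nat.choose (m + n - (d + b) * i) (n - b * i) : ℚ) := by
  rw [total, Finset.sum_filter, Finset.mul_sum]
  refine Finset.sum_congr rfl fun i _ => ?_
  by_cases h : b * i < n
  · have hdi : d * i ≤ b * i := Nat.mul_le_mul_right i hdb
    obtain ⟨k, hk⟩ : ∃ k, n = b * i + k + 1 := ⟨n - b * i - 1, by omega⟩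
    obtain ⟨M, hM⟩ : ∃ M, m = d * i + M := ⟨m - d * i, by omega⟩
    have hbi : b * i = (b - 1) * i + i := by
      obtain ⟨c, rfl⟩ := Nat.exists_eq_add_of_le' hb
      simp
      ring
    have e1 : n - b * i - 1 = k := by omega
    have e2 : m - d * i = M := by omega
    have e3 : n - (b - 1) * i - 1 = k + i := by omega
    have e4 : m + n - (d + b) * i = M + k + 1 := by
      rw [add_mul]
      omega
    have e5 : n - b * i = k + 1 := by omega
    rw [term, if_pos h, if_pos (by omega), e1, e2, e3, e4, e5, summand_eq, hk, hM]
    push_cast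
    ring
  · rw [term, if_neg h, if_neg (by omega), mul_zero]

lemma term_zero_sub {b d n m : ℕ} (hn : 2 ≤ n) (hm : 1 ≤ m) :
    term b d n m 0 - term b d n (m - 1) 0 = term b d (n - 1) m 0 := by
  obtain ⟨k, rfl⟩ := Nat.exists_eq_add_of_le' hn
  obtain ⟨M, rfl⟩ := Nat.exists_eq_add_of_le' hm
  simpa [term] using summand_succ_zero b d k M

lemma term_succ_sub {b d n m i : ℕ} (hdb : d ≤ b) (hnm : n ≤ m) :
    (term b d n m (i + 1) - term b d n (m - 1) (i + 1)) +
      (term b d (n - b) (m - d) i - term b d (n - b) (m - d - 1) i) =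
        term b d (n - 1) m (i + 1) := by
  have hdi : d * i ≤ b * i := Nat.mul_le_mul_right i hdb
  have hb1 : b * (i + 1) = b * i + b := by ring
  have hd1 : d * (i + 1) = d * i + d := by ring
  by_cases h : b * (i + 1) < n
  · obtain ⟨M, hM⟩ : ∃ M, m = d * i + d + M + 1 := ⟨m - d * i - d - 1, by omega⟩
    have e1 : m - d * (i + 1) = M + 1 := by omega
    have e2 : m - 1 - d * (i + 1) = M := by omega
    have e3 : m - d - d * i = M + 1 := by omega
    have e4 : m - d - 1 - d * i = M := by omega
    have e5 : n - b - b * i - 1 = n - b * (i + 1) - 1 := by omega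
    simp only [term, if_pos h, if_pos (show b * i < n - b by omega), e1, e2, e3, e4, e5]
    by_cases h' : b * (i + 1) < n - 1
    · obtain ⟨k, hk⟩ : ∃ k, n = b * (i + 1) + k + 2 := ⟨n - b * (i + 1) - 2, by omega⟩
      rw [if_pos h', show n - b * (i + 1) - 1 = k + 1 by omega,
        show n - 1 - b * (i + 1) - 1 = k by omega, ← summand_succ_succ b d k i M]
      ring
    · rw [if_neg h', show n - b * (i + 1) - 1 = 0 by omega]
      simp only [summand_zero]
      push_cast
      ring
  · simp only [term, if_neg h, if_neg (show ¬ b * i < n - b by omega),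
      if_neg (show ¬ b * (i + 1) < n - 1 by omega)]
    ring

lemma total_recurrence {b d n m : ℕ} (hb : 1 ≤ b) (hdb : d ≤ b) (hn : 2 ≤ n) (hnm : n ≤ m) :
    total b d n m = total b d n (m - 1) + total b d (n - 1) m -
      (total b d (n - b) (m - d) - total b d (n - b) (m - d - 1)) := by
  have hK : n ≤ n - 1 + 1 := by omega
  rw [total_eq_sum hb d m hK, total_eq_sum hb d (m - 1) hK,
    total_eq_sum hb d m (show n - 1 ≤ n - 1 + 1 by omega),
    total_eq_sum hb d (m - d) (show n - b ≤ n - 1 by omega),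
    total_eq_sum hb d (m - d - 1) (show n - b ≤ n - 1 by omega)]
  simp only [Finset.sum_range_succ']
  rw [← term_zero_sub hn (show 1 ≤ m by omega),
    ← Finset.sum_congr rfl fun i _ => term_succ_sub (i := i) hdb hnm]
  simp only [Finset.sum_add_distrib, Finset.sum_sub_distrib]
  ring

lemma total_one (b d m : ℕ) : total b d 1 m = m := by
  simp [total, term, summand_zero]

lemma total_zero (b d m : ℕ) : total b d 0 m = 0 := by
  simp [total]

lemma total_eq_zero {b d n m : ℕ} (hb : 1 ≤ b) (hdb : d ≤ b) (hnm : n = m + 1) :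
    total b d n m = 0 := by
  rw [total_eq hb hdb (by omega) hnm.le, hnm]
  push_cast
  ring

section Recurrence

variable {p q : Word} {b d : ℕ}

lemma s_recurrence_of_le (hform : p = Step.r :: (q ++ [Step.r])) (hdz : DepthZero p)
    (huniq : ∀ o : Word, IsBifix o p → o = [Step.r]) (hdimR : countR p = b + 1)
    (hdimU : countU p = d) {n m : ℤ} (hm : 1 ≤ m) (hnm : n ≤ m) (hnb : n ≤ b) :
    s p n m = s p n (m - 1) + s p (n - 1) m := by
  have h1 := s_add_endingAt (p := p) (by simp [hform]) hnm (by omega)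
  have h2 := s_eq_endingAt_add hform hdz huniq hdimR hdimU
    (le_of_depthZero hform hdz hdimR hdimU) hnm
  rw [s_eq_zero_of_neg (by omega)] at h2
  omega

lemma s_recurrence_of_lt (hform : p = Step.r :: (q ++ [Step.r])) (hdz : DepthZero p)
    (huniq : ∀ o : Word, IsBifix o p → o = [Step.r]) (hdimR : countR p = b + 1)
    (hdimU : countU p = d) {n m : ℤ} (hnm : n ≤ m) (hnb : b < n) :
    s p n m + s p (n - b) (m - d) =
      s p n (m - 1) + s p (n - 1) m + s p (n - b) (m - d - 1) := by
  have hdb := le_of_depthZero hform hdz hdimR hdimU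
  have h1 := s_add_endingAt (p := p) (by simp [hform]) hnm (by omega)
  have h2 := s_eq_endingAt_add hform hdz huniq hdimR hdimU hdb hnm
  have h3 := s_add_endingAt (p := p) (n := n - b) (m := m - d) (by simp [hform])
    (by omega) (by omega)
  omega

lemma s_zero_left (hform : p = Step.r :: (q ++ [Step.r])) (hdz : DepthZero p)
    (huniq : ∀ o : Word, IsBifix o p → o = [Step.r]) (hdimR : countR p = b + 1)
    (hdimU : countU p = d) (m : ℕ) : s p 0 m = 1 := by
  induction m with
  | zero => exact s_zero_zero (by simp [hform])
  | succ m ih =>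
    rw [s_recurrence_of_le hform hdz huniq hdimR hdimU (by omega) (by omega) (by omega),
      s_eq_zero_of_neg (n := 0 - 1) (by omega)]
    simpa using ih

lemma s_eq_total (hform : p = Step.r :: (q ++ [Step.r])) (hdz : DepthZero p)
    (huniq : ∀ o : Word, IsBifix o p → o = [Step.r]) (hdimR : countR p = b + 1)
    (hdimU : countU p = d) (hb : 1 ≤ b) (n : ℕ) :
    ∀ m : ℕ, 1 ≤ n → n ≤ m + 1 → (s p n m : ℚ) = total b d n m := by
  have hdb := le_of_depthZero hform hdz hdimR hdimU
  induction n using Nat.strong_induction_on with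
  | _ n ihn =>
    intro m
    induction m with
    | zero =>
      intro hn hnm
      rw [s_eq_zero_of_lt (by omega), total_eq_zero hb hdb (by omega), Nat.cast_zero]
    | succ m ihm =>
      intro hn hnm
      rcases Nat.lt_or_ge (m + 1) n with hlt | hle
      · rw [s_eq_zero_of_lt (by omega), total_eq_zero hb hdb (by omega), Nat.cast_zero]
      · have ihm' := ihm hn hle
        have em : ((m + 1 : ℕ) : ℤ) - 1 = (m : ℤ) := by omega
        have en : (n : ℤ) - 1 = ((n - 1 : ℕ) : ℤ) := by omega
        rcases Nat.lt_or_ge 1 n with h1 | h1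
        · have hprev := ihn (n - 1) (by omega) (m + 1) (by omega) (by omega)
          rw [total_recurrence hb hdb h1 hle, Nat.add_sub_cancel, ← ihm', ← hprev]
          rcases Nat.lt_or_ge b n with hbn | hbn
          · have h := s_recurrence_of_lt hform hdz huniq hdimR hdimU (n := n) (m := (m + 1 : ℕ))
              (by omega) (by omega)
            have eb : (n : ℤ) - b = ((n - b : ℕ) : ℤ) := by omega
            have ed : ((m + 1 : ℕ) : ℤ) - d = ((m + 1 - d : ℕ) : ℤ) := by omega
            have ed1 : ((m + 1 - d : ℕ) : ℤ) - 1 = ((m + 1 - d - 1 : ℕ) : ℤ) := by omega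
            rw [eb, ed, ed1, em, en] at h
            rw [← ihn (n - b) (by omega) (m + 1 - d) (by omega) (by omega),
              ← ihn (n - b) (by omega) (m + 1 - d - 1) (by omega) (by omega)]
            have h' := congrArg (Nat.cast : ℕ → ℚ) h
            push_cast at h' ⊢
            linarith
          · rw [s_recurrence_of_le hform hdz huniq hdimR hdimU (by omega) (by omega) (by omega),
              em, en, Nat.sub_eq_zero_of_le hbn, total_zero, total_zero]
            push_cast
            ring
        · obtain rfl : n = 1 := by omega
          rw [s_recurrence_of_le hform hdz huniq hdimR hdimU (by omega) (by omega) (by omega),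
            em, Nat.cast_add, ihm', total_one, total_one]
          have := s_zero_left hform hdz huniq hdimR hdimU (m + 1)
          simp at this ⊢
          exact this

end Recurrence

end BallotAvoiding

/-- Explicit formula for ballot paths avoiding a depth-zero pattern `p = r q r`
whose only bifix is the single letter `r`, with dimensions `(b+1) × d` (`b ≥ 1`):
for `m ≥ n ≥ 1`,
`s p n m = (m-n+1) ∑_{i ≥ 0, bi ≤ n-1} (-1)^i/(m-di+1) C(n-(b-1)i-1, i) C(m+n-(d+b)i, n-bi)`. -/
theorem ballot_avoiding_rqr_formula (p q : Word) (b d : ℕ)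
    (hform : p = Step.r :: (q ++ [Step.r]))
    (hdz : DepthZero p)
    (hbifix : IsBifix [Step.r] p)
    (huniq : ∀ o : Word, IsBifix o p → o = [Step.r])
    (hdimR : countR p = b + 1) (hdimU : countU p = d) (hb : 1 ≤ b)
    (n m : ℕ) (hn : 1 ≤ n) (hnm : n ≤ m) :
    (s p n m : ℚ) = ((m : ℚ) - n + 1) *
      ∑ i ∈ Finset.filter (fun i => b * i ≤ n - 1) (Finset.range n),
        (-1 : ℚ) ^ i * (1 / ((m : ℚ) - d * i + 1)) *
          (Nat.choose (n - (b - 1) * i - 1) i : ℚ) *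
          (Nat.choose (m + n - (d + b) * i) (n - b * i) : ℚ) := by
  rw [BallotAvoiding.s_eq_total hform hdz huniq hdimR hdimU hb n m hn (by omega),
    BallotAvoiding.total_eq hb (BallotAvoiding.le_of_depthZero hform hdz hdimR hdimU) hn
      (by omega)]
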